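/- Let l ≥ 1 be real and define ṽ(E,y) := √( (1 − |y|^{2l}) / (1 − V(q_M(E)·y)/E) ) for E > max(V(0),0) and y ∈ (−1,1). Then for every E₀ > max(V(0),0), ṽ(·,y) is C^∞ in E on [E₀,∞) for each y, and for every integer k ≥ 0 there is a constant C_k such that |∂_E^k ṽ(E,y)| ≤ C_k E^{−k} for all y ∈ (−1,1) and all E ≥ E₀. -/

import Mathlib

open Real MeasureTheory intervalIntegral

noncomputable section

/-- Japanese bracket `⟨x⟩ = √(1+x²)`. -/
def jap (x : ℝ) : ℝ := Real.sqrt (1 + x ^ 2)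

/-- The weight `λ(x,ξ) = (1+ξ²+|x|^{2l})^{1/(2l)}`. -/
def lam (l x ξ : ℝ) : ℝ := (1 + ξ ^ 2 + |x| ^ (2 * l)) ^ (1 / (2 * l))

/-- The symbol class `S^{m₁,m₂}`:  `g ∈ C^∞(ℝ²)` with
`|∂_ξ^{k₁}∂_x^{k₂} g(x,ξ)| ≤ C λ(x,ξ)^{m₁-k₁ l} ⟨x⟩^{m₂-k₂}`. -/
def IsSymbol (l m₁ m₂ : ℝ) (g : ℝ → ℝ → ℝ) : Prop :=
  ContDiff ℝ (⊤ : ℕ∞) (fun q : ℝ × ℝ => g q.1 q.2) ∧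
  ∀ k₁ k₂ : ℕ, ∃ C : ℝ, ∀ x ξ : ℝ,
    |iteratedDeriv k₁ (fun ξ' => iteratedDeriv k₂ (fun x' => g x' ξ') x) ξ|
      ≤ C * lam l x ξ ^ (m₁ - (k₁ : ℝ) * l) * jap x ^ (m₂ - (k₂ : ℝ))

/-- The standing assumptions on the potential `V`: it is `C^∞`, even, has no critical
points away from `0`, satisfies the symbol bounds `|∂_x^k V| ≤ C_k ⟨x⟩^{2l-k}`, and admits an
asymptotic expansion `V(x) ∼ |x|^{2l} + Σ_{j≥1} V_{2l-2j}(x)` with `V_{2l-2j}` smooth away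
from zero and positively homogeneous of degree `2l-2j`. -/
structure GoodPotential (l : ℝ) (V : ℝ → ℝ) : Prop where
  smooth : ContDiff ℝ (⊤ : ℕ∞) V
  even : ∀ x : ℝ, V (-x) = V x
  deriv_ne : ∀ x : ℝ, x ≠ 0 → deriv V x ≠ 0
  growth : ∀ k : ℕ, ∃ C : ℝ, ∀ x : ℝ, |iteratedDeriv k V x| ≤ C * jap x ^ (2 * l - (k : ℝ))
  expansion : ∃ Vh : ℕ → ℝ → ℝ,
    (∀ j : ℕ, 1 ≤ j →
      ContDiffOn ℝ (⊤ : ℕ∞) (Vh j) {x : ℝ | x ≠ 0} ∧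
      ∀ ρ : ℝ, 0 < ρ → ∀ x : ℝ, Vh j (ρ * x) = ρ ^ (2 * l - 2 * (j : ℝ)) * Vh j x) ∧
    ∀ N k : ℕ, ∃ C R : ℝ, ∀ x : ℝ, R ≤ |x| →
      |iteratedDeriv k (fun y => V y - |y| ^ (2 * l) - ∑ j ∈ Finset.Icc 1 N, Vh j y) x|
        ≤ C * |x| ^ (2 * l - 2 * ((N : ℝ) + 1) - (k : ℝ))

/-- `qM` is the turning point function: the unique positive solution of `V(q_M(E)) = E`
for `E > V 0`. -/
def IsTurningPoint (V qM : ℝ → ℝ) : Prop :=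
  ∀ E : ℝ, V 0 < E →
    0 < qM E ∧ V (qM E) = E ∧ ∀ q : ℝ, 0 < q → V q = E → q = qM E

/-- The period `T(E) = 4∫₀^{q_M(E)} dq/√(E-V(q))`. -/
def period (V qM : ℝ → ℝ) (E : ℝ) : ℝ :=
  4 * ∫ q in (0:ℝ)..(qM E), (Real.sqrt (E - V q))⁻¹

/-- The orbit average
`⟨p⟩(E) = (1/T(E)) ∫_{-q_M}^{q_M} [p(q,√(E-V q)) + p(q,-√(E-V q))]/√(E-V q) dq`. -/
def orbitAvg (V qM : ℝ → ℝ) (p : ℝ → ℝ → ℝ) (E : ℝ) : ℝ :=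
  (period V qM E)⁻¹ *
    ∫ q in (-(qM E))..(qM E),
      (p q (Real.sqrt (E - V q)) + p q (-Real.sqrt (E - V q))) / Real.sqrt (E - V q)

/-- `ṽ(E,y) = √((1-|y|^{2l})/(1-V(q_M(E)y)/E))`. -/
def vtil (l : ℝ) (V qM : ℝ → ℝ) (E y : ℝ) : ℝ :=
  Real.sqrt ((1 - |y| ^ (2 * l)) / (1 - V (qM E * y) / E))

/-- A family `f i` is Euler bounded to order `n` on `S` if `(E d/dE)^k f i` exists and is bounded
on `S`, uniformly in `i`, for every `k ≤ n`. -/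
def EulerBounded {ι : Type} (S : Set ℝ) : ℕ → (ι → ℝ → ℝ) → Prop
  | 0, f => ∃ C, ∀ i, ∀ E ∈ S, |f i E| ≤ C
  | n + 1, f => (∃ C, ∀ i, ∀ E ∈ S, |f i E| ≤ C) ∧
      ∃ g : ι → ℝ → ℝ, (∀ i, ∀ E ∈ S, HasDerivWithinAt (f i) (g i E / E) S E) ∧
        EulerBounded S n g

namespace EulerBounded

variable {ι : Type} {S : Set ℝ} {n : ℕ} {f g : ι → ℝ → ℝ}

theorem bound (hf : EulerBounded S n f) : ∃ C, ∀ i, ∀ E ∈ S, |f i E| ≤ C := by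
  cases n with
  | zero => exact hf
  | succ n => exact hf.1

theorem of_succ (hf : EulerBounded S (n + 1) f) : EulerBounded S n f := by
  induction n generalizing f with
  | zero => exact hf.1
  | succ n ih =>
    obtain ⟨hb, g, hg, hn⟩ := hf
    exact ⟨hb, g, hg, ih hn⟩

theorem congr (hf : EulerBounded S n f) (h : ∀ i, ∀ E ∈ S, g i E = f i E) :
    EulerBounded S n g := by
  have hb : ∃ C, ∀ i, ∀ E ∈ S, |g i E| ≤ C := by
    obtain ⟨C, hC⟩ := hf.bound
    exact ⟨C, fun i E hE => by rw [h i E hE]; exact hC i E hE⟩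
  cases n with
  | zero => exact hb
  | succ n =>
    obtain ⟨-, g', hg', hn⟩ := hf
    exact ⟨hb, g', fun i E hE => (hg' i E hE).congr (fun x hx => h i x hx) (h i E hE), hn⟩

theorem sub (hf : EulerBounded S n f) (hg : EulerBounded S n g) :
    EulerBounded S n (fun i E => f i E - g i E) := by
  induction n generalizing f g with
  | zero =>
    obtain ⟨C, hC⟩ := hf
    obtain ⟨D, hD⟩ := hg
    exact ⟨C + D, fun i E hE => (abs_sub _ _).trans (add_le_add (hC i E hE) (hD i E hE))⟩
  | succ n ih =>
    refine ⟨(ih hf.of_succ hg.of_succ).bound, ?_⟩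
    obtain ⟨-, f', hf', hfn⟩ := hf
    obtain ⟨-, g', hg', hgn⟩ := hg
    refine ⟨_, fun i E hE => ?_, ih hfn hgn⟩
    rw [sub_div]
    exact (hf' i E hE).fun_sub (hg' i E hE)

theorem add (hf : EulerBounded S n f) (hg : EulerBounded S n g) :
    EulerBounded S n (fun i E => f i E + g i E) := by
  induction n generalizing f g with
  | zero =>
    obtain ⟨C, hC⟩ := hf
    obtain ⟨D, hD⟩ := hg
    exact ⟨C + D, fun i E hE => (abs_add_le _ _).trans (add_le_add (hC i E hE) (hD i E hE))⟩
  | succ n ih =>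
    refine ⟨(ih hf.of_succ hg.of_succ).bound, ?_⟩
    obtain ⟨-, f', hf', hfn⟩ := hf
    obtain ⟨-, g', hg', hgn⟩ := hg
    refine ⟨_, fun i E hE => ?_, ih hfn hgn⟩
    rw [add_div]
    exact (hf' i E hE).fun_add (hg' i E hE)

theorem mul (hf : EulerBounded S n f) (hg : EulerBounded S n g) :
    EulerBounded S n (fun i E => f i E * g i E) := by
  induction n generalizing f g with
  | zero =>
    obtain ⟨C, hC⟩ := hf
    obtain ⟨D, hD⟩ := hg
    refine ⟨C * D, fun i E hE => ?_⟩
    rw [abs_mul]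
    exact mul_le_mul (hC i E hE) (hD i E hE) (abs_nonneg _) ((abs_nonneg _).trans (hC i E hE))
  | succ n ih =>
    refine ⟨(ih hf.of_succ hg.of_succ).bound, ?_⟩
    have hf₀ := hf.of_succ
    have hg₀ := hg.of_succ
    obtain ⟨-, f', hf', hfn⟩ := hf
    obtain ⟨-, g', hg', hgn⟩ := hg
    refine ⟨_, fun i E hE => ?_, (ih hfn hg₀).add (ih hf₀ hgn)⟩
    exact ((hf' i E hE).fun_mul (hg' i E hE)).congr_deriv (by ring)

theorem const_mul (c : ℝ) (hf : EulerBounded S n f) :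
    EulerBounded S n (fun i E => c * f i E) := by
  induction n generalizing f with
  | zero =>
    obtain ⟨C, hC⟩ := hf
    exact ⟨|c| * C, fun i E hE => by
      rw [abs_mul]; exact mul_le_mul_of_nonneg_left (hC i E hE) (abs_nonneg _)⟩
  | succ n ih =>
    refine ⟨(ih hf.of_succ).bound, ?_⟩
    obtain ⟨-, f', hf', hfn⟩ := hf
    refine ⟨_, fun i E hE => ?_, ih hfn⟩
    rw [mul_div_assoc]
    exact (hf' i E hE).const_mul c

theorem inv (hf : EulerBounded S n f) {c : ℝ} (hc : 0 < c) (hfc : ∀ i, ∀ E ∈ S, c ≤ f i E) :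
    EulerBounded S n (fun i E => (f i E)⁻¹) := by
  induction n with
  | zero =>
    refine ⟨c⁻¹, fun i E hE => ?_⟩
    have := hfc i E hE
    rw [abs_of_nonneg (inv_nonneg.2 (hc.le.trans this))]
    exact inv_anti₀ hc this
  | succ n ih =>
    have h := ih hf.of_succ
    obtain ⟨-, f', hf', hfn⟩ := hf
    refine ⟨h.bound, _, fun i E hE => ?_, (hfn.mul (h.mul h)).const_mul (-1)⟩
    refine ((hf' i E hE).fun_inv (hc.trans_le (hfc i E hE)).ne').congr_deriv ?_
    simp only [div_eq_mul_inv, mul_inv, pow_two]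
    ring

theorem sqrt (hf : EulerBounded S n f) {c : ℝ} (hc : 0 < c) (hfc : ∀ i, ∀ E ∈ S, c ≤ f i E) :
    EulerBounded S n (fun i E => √(f i E)) := by
  induction n with
  | zero =>
    obtain ⟨C, hC⟩ := hf
    refine ⟨√C, fun i E hE => ?_⟩
    rw [abs_of_nonneg (Real.sqrt_nonneg _)]
    exact Real.sqrt_le_sqrt ((le_abs_self _).trans (hC i E hE))
  | succ n ih =>
    have h := ih hf.of_succ
    have hi := hf.of_succ.inv hc hfc
    obtain ⟨-, f', hf', hfn⟩ := hf
    refine ⟨h.bound, _, fun i E hE => ?_, (hfn.mul (hi.mul h)).const_mul (1 / 2)⟩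
    have hp := hc.trans_le (hfc i E hE)
    refine ((hf' i E hE).sqrt hp.ne').congr_deriv ?_
    have hs : (f i E)⁻¹ * √(f i E) = (√(f i E))⁻¹ := by
      have := Real.sqrt_pos.2 hp
      field_simp
      exact Real.sq_sqrt hp.le
    rw [hs]
    simp only [div_eq_mul_inv, mul_inv]
    ring

theorem iteratedDerivWithin_eq (hS : UniqueDiffOn ℝ S) (hS₀ : ∀ E ∈ S, 0 < E) (k : ℕ)
    (hf : EulerBounded S (n + k) f) :
    ∃ h : ι → ℝ → ℝ, EulerBounded S n h ∧
      ∀ i, ∀ E ∈ S, iteratedDerivWithin k (f i) S E = h i E / E ^ k := by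
  induction k generalizing n with
  | zero => exact ⟨f, hf, fun i E _ => by simp⟩
  | succ k ih =>
    obtain ⟨h, hh, hk⟩ := ih (n := n + 1) (by convert hf using 1; ring)
    have h₀ := hh.of_succ
    obtain ⟨-, g, hg, hn⟩ := hh
    refine ⟨_, hn.sub (h₀.const_mul k), fun i E hE => ?_⟩
    have hE₀ := (hS₀ E hE).ne'
    rw [iteratedDerivWithin_succ, derivWithin_congr (hk i) (hk i E hE)]
    refine (((hg i E hE).fun_div (hasDerivAt_pow k E).hasDerivWithinAt
      (pow_ne_zero k hE₀)).congr_deriv ?_).derivWithin (hS E hE)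
    cases k with
    | zero => simp
    | succ k =>
      field_simp
      simp only [add_tsub_cancel_right]
      push_cast
      ring

theorem contDiffOn (hS : UniqueDiffOn ℝ S) (hS₀ : ∀ E ∈ S, 0 < E)
    (hf : EulerBounded S (n + 1) f) (i : ι) : ContDiffOn ℝ n (f i) S := by
  induction n generalizing f with
  | zero =>
    obtain ⟨-, g, hg, -⟩ := hf
    exact contDiffOn_zero.2 fun E hE => (hg i E hE).continuousWithinAt
  | succ n ih =>
    obtain ⟨-, g, hg, hn⟩ := hf
    rw [Nat.cast_succ, contDiffOn_succ_iff_derivWithin hS]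
    refine ⟨fun E hE => (hg i E hE).differentiableWithinAt, by simp, ?_⟩
    refine ((ih hn).div contDiffOn_id fun E hE => (hS₀ E hE).ne').congr fun E hE => ?_
    exact (hg i E hE).derivWithin (hS E hE)

end EulerBounded

theorem jap_pos (x : ℝ) : 0 < jap x := Real.sqrt_pos.2 (by positivity)

theorem abs_le_jap (x : ℝ) : |x| ≤ jap x :=
  Real.abs_le_sqrt (by linarith [sq_nonneg x])

theorem jap_le_jap {x y : ℝ} (hx : 0 ≤ x) (h : x ≤ y) : jap x ≤ jap y :=
  Real.sqrt_le_sqrt (by nlinarith)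

theorem jap_le_two_mul {x : ℝ} (hx : 1 ≤ x) : jap x ≤ 2 * x :=
  Real.sqrt_le_iff.2 ⟨by linarith, by nlinarith⟩

theorem jap_le_two_mul_jap_half (x : ℝ) : jap x ≤ 2 * jap (x / 2) := by
  refine Real.sqrt_le_iff.2 ⟨by linarith [jap_pos (x / 2)], ?_⟩
  rw [mul_pow, jap, Real.sq_sqrt (by positivity)]
  nlinarith

theorem continuous_jap : Continuous jap := by
  unfold jap
  fun_prop

/-- One-variable symbols of order `m`. -/
structure IsSymbolOne (m : ℝ) (f : ℝ → ℝ) : Prop where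
  smooth : ContDiff ℝ (⊤ : ℕ∞) f
  bound : ∀ k : ℕ, ∃ C : ℝ, ∀ x : ℝ, |iteratedDeriv k f x| ≤ C * jap x ^ (m - (k : ℝ))

theorem iteratedDeriv_id_mul_deriv {f : ℝ → ℝ} (hf : ContDiff ℝ (⊤ : ℕ∞) f) (k : ℕ) :
    iteratedDeriv k (fun x => x * deriv f x) =
      fun x => x * iteratedDeriv (k + 1) f x + k * iteratedDeriv k f x := by
  have hd : ∀ (m : ℕ) x, HasDerivAt (iteratedDeriv m f) (iteratedDeriv (m + 1) f x) x := by
    intro m x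
    rw [iteratedDeriv_succ]
    exact (hf.differentiable_iteratedDeriv m (by exact_mod_cast WithTop.coe_lt_top m)
      x).hasDerivAt
  induction k with
  | zero => simp
  | succ k ih =>
    rw [iteratedDeriv_succ, ih]
    ext x
    refine (((hasDerivAt_id' x).fun_mul (hd (k + 1) x)).fun_add
      ((hd k x).const_mul (k : ℝ))).deriv.trans ?_
    push_cast
    ring

theorem IsSymbolOne.id_mul_deriv {m : ℝ} {f : ℝ → ℝ} (hf : IsSymbolOne m f) :
    IsSymbolOne m (fun x => x * deriv f x) := by
  refine ⟨contDiff_id.mul (contDiff_infty_iff_deriv.1 hf.smooth).2, fun k => ?_⟩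
  obtain ⟨C, hC⟩ := hf.bound k
  obtain ⟨D, hD⟩ := hf.bound (k + 1)
  refine ⟨D + k * C, fun x => ?_⟩
  rw [iteratedDeriv_id_mul_deriv hf.smooth]
  have hj := jap_pos x
  have h1 : jap x * jap x ^ (m - ((k + 1 : ℕ) : ℝ)) = jap x ^ (m - (k : ℝ)) := by
    rw [mul_comm, ← Real.rpow_add_one hj.ne']
    congr 1
    push_cast
    ring
  have h2 : |x * iteratedDeriv (k + 1) f x| ≤ D * jap x ^ (m - (k : ℝ)) := by
    rw [abs_mul, ← h1]
    calc |x| * |iteratedDeriv (k + 1) f x|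
        ≤ jap x * (D * jap x ^ (m - ((k + 1 : ℕ) : ℝ))) :=
          mul_le_mul (abs_le_jap x) (hD x) (abs_nonneg _) hj.le
      _ = _ := by ring
  have h3 : |(k : ℝ) * iteratedDeriv k f x| ≤ k * (C * jap x ^ (m - (k : ℝ))) := by
    rw [abs_mul, Nat.abs_cast]
    exact mul_le_mul_of_nonneg_left (hC x) (Nat.cast_nonneg k)
  calc _ ≤ _ := abs_add_le _ _
    _ ≤ _ := add_le_add h2 h3
    _ = _ := by ring

/-- The Euler operator iterates `(x d/dx)^j V`. -/
def eulerIter (V : ℝ → ℝ) : ℕ → ℝ → ℝ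
  | 0 => V
  | j + 1 => fun x => x * deriv (eulerIter V j) x

theorem IsSymbolOne.eulerIter {m : ℝ} {V : ℝ → ℝ} (hV : IsSymbolOne m V) (j : ℕ) :
    IsSymbolOne m (eulerIter V j) := by
  induction j with
  | zero => exact hV
  | succ j ih => exact ih.id_mul_deriv

theorem IsSymbolOne.abs_sub_le {m : ℝ} (hm : 1 ≤ m) {f : ℝ → ℝ} (hf : IsSymbolOne m f) :
    ∃ C, 0 ≤ C ∧ ∀ q y : ℝ, 0 ≤ q → 0 ≤ y → y ≤ 1 →
      |f q - f (q * y)| ≤ C * jap q ^ m * (1 - y) := by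
  obtain ⟨C, hC⟩ := hf.bound 1
  have hC₀ : 0 ≤ C := by
    have := (abs_nonneg _).trans (hC 0)
    exact nonneg_of_mul_nonneg_left this (Real.rpow_pos_of_pos (jap_pos 0) _)
  refine ⟨C, hC₀, fun q y hq hy hy1 => ?_⟩
  have hj := jap_pos q
  have key : ‖f q - f (q * y)‖ ≤ C * jap q ^ (m - 1) * ‖q - q * y‖ := by
    refine Convex.norm_image_sub_le_of_norm_deriv_le (s := Set.Icc 0 q)
      (fun x _ => (hf.smooth.differentiable (by simp)) x) (fun x hx => ?_) (convex_Icc 0 q)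
      ⟨by positivity, mul_le_of_le_one_right hq hy1⟩ ⟨hq, le_rfl⟩
    have := hC x
    rw [iteratedDeriv_one, Nat.cast_one] at this
    exact this.trans (mul_le_mul_of_nonneg_left (Real.rpow_le_rpow (jap_pos x).le
      (jap_le_jap hx.1 hx.2) (by linarith)) hC₀)
  have hq1 : q - q * y = q * (1 - y) := by ring
  rw [Real.norm_eq_abs, Real.norm_eq_abs, hq1, abs_mul, abs_of_nonneg (sub_nonneg.2 hy1)] at key
  refine key.trans ?_
  have h1 : jap q ^ m = jap q ^ (m - 1) * jap q := by
    rw [← Real.rpow_add_one hj.ne']; congr 1; ring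
  rw [h1, ← mul_assoc, ← mul_assoc]
  refine mul_le_mul_of_nonneg_right ?_ (sub_nonneg.2 hy1)
  exact mul_le_mul_of_nonneg_left (abs_le_jap q)
    (mul_nonneg hC₀ (Real.rpow_pos_of_pos hj _).le)

theorem exists_mul_jap_rpow_le {p : ℝ} (hp : 0 ≤ p) {f : ℝ → ℝ} (hf : Continuous f) {δ R : ℝ}
    (hpos : ∀ x, δ ≤ x → 0 < f x) (hR : ∀ x, R ≤ x → x ^ p / 2 ≤ f x) :
    ∃ c, 0 < c ∧ ∀ x, δ ≤ x → c * jap x ^ p ≤ f x := by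
  set R' := max R (max δ 1)
  have hcont : Continuous fun x => f x / jap x ^ p :=
    hf.div (continuous_jap.rpow_const fun x => Or.inr hp)
      fun x => (Real.rpow_pos_of_pos (jap_pos x) p).ne'
  obtain ⟨x₀, hx₀, hmin⟩ := isCompact_Icc.exists_isMinOn
    (Set.nonempty_Icc.2 ((le_max_left δ 1).trans (le_max_right R _)))
    (hcont.continuousOn (s := Set.Icc δ R'))
  have h₀ : 0 < f x₀ / jap x₀ ^ p :=
    div_pos (hpos x₀ hx₀.1) (Real.rpow_pos_of_pos (jap_pos x₀) p)
  have h₁ : (0 : ℝ) < (2 ^ p * 2)⁻¹ := by positivity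
  refine ⟨min (f x₀ / jap x₀ ^ p) (2 ^ p * 2)⁻¹, lt_min h₀ h₁, fun x hx => ?_⟩
  have hj := Real.rpow_pos_of_pos (jap_pos x) p
  rcases le_total x R' with h | h
  · refine (mul_le_mul_of_nonneg_right (min_le_left _ _) hj.le).trans ?_
    rw [← le_div_iff₀ hj]
    exact hmin ⟨hx, h⟩
  · have hx1 : 1 ≤ x := (le_max_right δ 1).trans ((le_max_right R _).trans h)
    refine (mul_le_mul_of_nonneg_right (min_le_right _ _) hj.le).trans ?_
    refine le_trans ?_ (hR x ((le_max_left R _).trans h))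
    have : jap x ^ p ≤ 2 ^ p * x ^ p := by
      rw [← Real.mul_rpow (by norm_num) (by linarith)]
      exact Real.rpow_le_rpow (jap_pos x).le (jap_le_two_mul hx1) hp
    rw [inv_mul_le_iff₀ (by positivity)]
    linarith

namespace GoodPotential

variable {l : ℝ} {V : ℝ → ℝ}

theorem isSymbolOne (hV : GoodPotential l V) : IsSymbolOne (2 * l) V :=
  ⟨hV.smooth, hV.growth⟩

theorem hasDerivAt (hV : GoodPotential l V) (x : ℝ) : HasDerivAt V (deriv V x) x :=
  (hV.smooth.differentiable (by simp) x).hasDerivAt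

theorem exists_half_rpow_le (hV : GoodPotential l V) :
    ∃ R, ∀ x, R ≤ x → x ^ (2 * l) / 2 ≤ V x := by
  obtain ⟨Vh, -, h⟩ := hV.expansion
  obtain ⟨C, R, hR⟩ := h 0 0
  refine ⟨max R (max 1 (2 * C)), fun x hx => ?_⟩
  have hx1 : 1 ≤ x := (le_max_left 1 (2 * C)).trans ((le_max_right R _).trans hx)
  have hxC : 2 * C ≤ x := (le_max_right 1 (2 * C)).trans ((le_max_right R _).trans hx)
  have hx₀ : 0 < x := by linarith
  have := hR x (by rw [abs_of_pos hx₀]; exact (le_max_left R _).trans hx)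
  simp only [iteratedDeriv_zero, zero_lt_one, Finset.Icc_eq_empty_of_lt, Finset.sum_empty,
    sub_zero, Nat.cast_zero, zero_add, mul_one, abs_of_pos hx₀] at this
  have hp : 0 < x ^ (2 * l - 2) := Real.rpow_pos_of_pos hx₀ _
  have hs : x ^ (2 * l) = x ^ (2 * l - 2) * (x * x) := by
    rw [← pow_two, ← Real.rpow_add_natCast hx₀.ne']; congr 1; push_cast; ring
  have h2 := (abs_le.1 this).1
  have h3 : 0 ≤ x ^ (2 * l - 2) * (x * x - 2 * C) := mul_nonneg hp.le (by nlinarith)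
  rw [hs] at h2 ⊢
  nlinarith

theorem exists_half_rpow_le_id_mul_deriv (hl : 1 ≤ l) (hV : GoodPotential l V) :
    ∃ R, ∀ x, R ≤ x → x ^ (2 * l) / 2 ≤ x * deriv V x := by
  obtain ⟨Vh, -, h⟩ := hV.expansion
  obtain ⟨C, R, hR⟩ := h 0 1
  refine ⟨max R (max 1 C), fun x hx => ?_⟩
  have hx1 : 1 ≤ x := (le_max_left 1 C).trans ((le_max_right R _).trans hx)
  have hxC : C ≤ x := (le_max_right 1 C).trans ((le_max_right R _).trans hx)
  have hx₀ : 0 < x := by linarith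
  have := hR x (by rw [abs_of_pos hx₀]; exact (le_max_left R _).trans hx)
  simp only [iteratedDeriv_one, zero_lt_one, Finset.Icc_eq_empty_of_lt, Finset.sum_empty,
    sub_zero, Nat.cast_zero, zero_add, mul_one, abs_of_pos hx₀, Nat.cast_one] at this
  have hd : HasDerivAt (fun y => V y - |y| ^ (2 * l))
      (deriv V x - 2 * l * x ^ (2 * l - 1)) x := by
    refine (hV.hasDerivAt x).fun_sub
      ((Real.hasDerivAt_rpow_const (Or.inl hx₀.ne')).congr_of_eventuallyEq ?_)
    filter_upwards [lt_mem_nhds hx₀] with y hy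
    rw [abs_of_pos hy]
  rw [hd.deriv] at this
  have hp : 0 < x ^ (2 * l - 2 - 1) := Real.rpow_pos_of_pos hx₀ _
  have hs : x ^ (2 * l - 1) = x ^ (2 * l - 2 - 1) * (x * x) := by
    rw [← pow_two, ← Real.rpow_add_natCast hx₀.ne']; congr 1; push_cast; ring
  have hs' : x ^ (2 * l) = x * x ^ (2 * l - 1) := by
    rw [mul_comm x, ← Real.rpow_add_one hx₀.ne']; congr 1; ring
  have h2 := (abs_le.1 this).1
  rw [hs', mul_div_assoc]
  refine mul_le_mul_of_nonneg_left ?_ hx₀.le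
  rw [hs] at h2 ⊢
  have h3 : 0 ≤ x ^ (2 * l - 2 - 1) * (x * x - C) := mul_nonneg hp.le (by nlinarith)
  have h4 : 0 ≤ (l - 1) * (x ^ (2 * l - 2 - 1) * (x * x)) :=
    mul_nonneg (by linarith) (by positivity)
  have h5 : 0 < x ^ (2 * l - 2 - 1) * (x * x) := by positivity
  nlinarith

theorem deriv_pos (hl : 1 ≤ l) (hV : GoodPotential l V) {x : ℝ} (hx : 0 < x) :
    0 < deriv V x := by
  rcases hasDerivWithinAt_forall_lt_or_forall_gt_of_forall_ne (convex_Ioi (0 : ℝ))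
    (fun x _ => (hV.hasDerivAt x).hasDerivWithinAt) (m := 0)
    (fun x hx => hV.deriv_ne x (ne_of_gt hx)) with h | h
  · obtain ⟨R, hR⟩ := hV.exists_half_rpow_le_id_mul_deriv hl
    have hm : 0 < max R 1 := lt_max_of_lt_right one_pos
    have h1 := hR _ (le_max_left R 1)
    have h2 : 0 < (max R 1) ^ (2 * l) := Real.rpow_pos_of_pos hm _
    have h3 := mul_neg_of_pos_of_neg hm (h _ hm)
    linarith
  · exact h x hx

theorem strictMonoOn (hl : 1 ≤ l) (hV : GoodPotential l V) : StrictMonoOn V (Set.Ici 0) := by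
  refine strictMonoOn_of_deriv_pos (convex_Ici 0) hV.smooth.continuous.continuousOn fun x hx => ?_
  rw [interior_Ici] at hx
  exact hV.deriv_pos hl hx

theorem exists_mul_le_sub (hl : 1 ≤ l) (hV : GoodPotential l V) {δ : ℝ} (hδ : 0 < δ) :
    ∃ c, 0 < c ∧ ∀ q y, δ ≤ q → 0 ≤ y → y < 1 →
      c * jap q ^ (2 * l) * (1 - y) ≤ V q - V (q * y) := by
  obtain ⟨R, hR⟩ := hV.exists_half_rpow_le_id_mul_deriv hl
  obtain ⟨c, hc, h⟩ := exists_mul_jap_rpow_le (p := 2 * l) (by linarith)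
    (hV.isSymbolOne.id_mul_deriv.smooth.continuous) (δ := δ / 2)
    (fun x hx => mul_pos (by linarith) (hV.deriv_pos hl (by linarith))) hR
  refine ⟨c * (2 ^ (2 * l))⁻¹ / 2, by positivity, fun q y hq hy hy1 => ?_⟩
  have hq₀ : 0 < q := by linarith
  have hz : max (q * y) (q / 2) < q := max_lt (by nlinarith) (by linarith)
  obtain ⟨s, hs, hsV⟩ := exists_deriv_eq_slope V hz hV.smooth.continuous.continuousOn
    (fun x _ => (hV.hasDerivAt x).differentiableAt.differentiableWithinAt)
  have hs2 : q / 2 < s := (le_max_right _ _).trans_lt hs.1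
  rw [eq_div_iff (by linarith)] at hsV
  have hVz : V (q * y) ≤ V (max (q * y) (q / 2)) :=
    (hV.strictMonoOn hl).monotoneOn (Set.mem_Ici.2 (by positivity))
      (Set.mem_Ici.2 (le_max_of_le_left (by positivity))) (le_max_left _ _)
  have hqz : q * (1 - y) / 2 ≤ q - max (q * y) (q / 2) := by
    rcases le_total (q * y) (q / 2) with h' | h'
    · rw [max_eq_right h']; nlinarith
    · rw [max_eq_left h']; nlinarith
  have hd := hV.deriv_pos hl (x := s) (by linarith)
  have hj : (2 ^ (2 * l))⁻¹ * jap q ^ (2 * l) ≤ jap s ^ (2 * l) := by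
    rw [inv_mul_le_iff₀ (by positivity), ← Real.mul_rpow (by norm_num) (jap_pos s).le]
    refine Real.rpow_le_rpow (jap_pos q).le ((jap_le_two_mul_jap_half q).trans ?_) (by linarith)
    exact mul_le_mul_of_nonneg_left (jap_le_jap (by linarith) hs2.le) (by norm_num)
  calc c * (2 ^ (2 * l))⁻¹ / 2 * jap q ^ (2 * l) * (1 - y)
      = c * ((2 ^ (2 * l))⁻¹ * jap q ^ (2 * l)) * ((1 - y) / 2) := by ring
    _ ≤ (q * deriv V s) * ((1 - y) / 2) := by
        refine mul_le_mul_of_nonneg_right ?_ (by linarith)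
        refine (mul_le_mul_of_nonneg_left hj hc.le).trans ((h s (by linarith)).trans ?_)
        exact mul_le_mul_of_nonneg_right hs.2.le hd.le
    _ = deriv V s * (q * (1 - y) / 2) := by ring
    _ ≤ deriv V s * (q - max (q * y) (q / 2)) := mul_le_mul_of_nonneg_left hqz hd.le
    _ ≤ V q - V (q * y) := by linarith

theorem hasDerivAt_turningPoint (hl : 1 ≤ l) (hV : GoodPotential l V) {qM : ℝ → ℝ}
    (hqM : IsTurningPoint V qM) {E : ℝ} (hE : V 0 < E) :
    HasDerivAt qM (deriv V (qM E))⁻¹ E := by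
  have hmono := hV.strictMonoOn hl
  have hq : StrictMonoOn qM (Set.Ioi (V 0)) := by
    intro a ha b hb hab
    obtain ⟨ha₀, haV, -⟩ := hqM a ha
    obtain ⟨hb₀, hbV, -⟩ := hqM b hb
    rw [← hmono.lt_iff_lt (Set.mem_Ici.2 ha₀.le) (Set.mem_Ici.2 hb₀.le), haV, hbV]
    exact hab
  have himg : Set.Ioi 0 ⊆ qM '' Set.Ioi (V 0) := by
    intro q hq₀
    have h := hmono (Set.mem_Ici.2 le_rfl) (Set.mem_Ici.2 (le_of_lt hq₀)) hq₀
    exact ⟨V q, h, ((hqM (V q) h).2.2 q hq₀ rfl).symm⟩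
  have hc : ContinuousAt qM E := hq.continuousAt_of_image_mem_nhds (Ioi_mem_nhds hE)
    (Filter.mem_of_superset (Ioi_mem_nhds (hqM E hE).1) himg)
  refine HasDerivAt.of_local_left_inverse hc (hV.hasDerivAt _)
    (hV.deriv_pos hl (hqM E hE).1).ne' ?_
  filter_upwards [lt_mem_nhds hE] with x hx using (hqM x hx).2.1

end GoodPotential

theorem one_sub_rpow_le {p y : ℝ} (hp : 1 ≤ p) (hy : 0 ≤ y) : 1 - y ^ p ≤ p * (1 - y) := by
  have := one_add_mul_self_le_rpow_one_add (s := y - 1) (by linarith) hp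
  rw [add_sub_cancel] at this
  linarith

theorem one_sub_le_one_sub_rpow {p y : ℝ} (hp : 1 ≤ p) (hy : 0 ≤ y) (hy1 : y ≤ 1) :
    1 - y ≤ 1 - y ^ p := by
  linarith [Real.rpow_le_self_of_le_one hy hy1 hp]

/-- The difference `f(q_M(E)) - f(q_M(E) y)` normalized by `E (1 - y^{2l})`. -/
def normalizedDiff (l : ℝ) (f qM : ℝ → ℝ) (y : Set.Ico (0 : ℝ) 1) (E : ℝ) : ℝ :=
  (f (qM E) - f (qM E * y)) / (E * (1 - (y : ℝ) ^ (2 * l)))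

namespace GoodPotential

variable {l : ℝ} {V qM : ℝ → ℝ} {E₀ : ℝ}

theorem le_qM (hl : 1 ≤ l) (hV : GoodPotential l V) (hqM : IsTurningPoint V qM)
    (hE₀ : V 0 < E₀) {E : ℝ} (hE : E₀ ≤ E) : qM E₀ ≤ qM E := by
  obtain ⟨h1, h2, -⟩ := hqM E₀ hE₀
  obtain ⟨h3, h4, -⟩ := hqM E (hE₀.trans_le hE)
  rw [← (hV.strictMonoOn hl).le_iff_le (Set.mem_Ici.2 h1.le) (Set.mem_Ici.2 h3.le), h2, h4]
  exact hE

theorem exists_jap_rpow_le_energy (hl : 1 ≤ l) (hV : GoodPotential l V)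
    (hqM : IsTurningPoint V qM) (hE₀ : max (V 0) 0 < E₀) :
    ∃ c, 0 < c ∧ ∀ E, E₀ ≤ E → c * jap (qM E) ^ (2 * l) ≤ E := by
  obtain ⟨hV₀, hp₀⟩ := max_lt_iff.1 hE₀
  obtain ⟨R, hR⟩ := hV.exists_half_rpow_le
  obtain ⟨h1, h2, -⟩ := hqM E₀ hV₀
  obtain ⟨c, hc, h⟩ := exists_mul_jap_rpow_le (p := 2 * l) (by linarith) hV.smooth.continuous
    (δ := qM E₀) (fun x hx => hp₀.trans_le (h2 ▸ (hV.strictMonoOn hl).monotoneOn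
      (Set.mem_Ici.2 h1.le) (Set.mem_Ici.2 (h1.le.trans hx)) hx)) hR
  refine ⟨c, hc, fun E hE => ?_⟩
  have := h (qM E) (le_qM hl hV hqM hV₀ hE)
  rwa [(hqM E (hV₀.trans_le hE)).2.1] at this

theorem exists_energy_le_jap_rpow (hV : GoodPotential l V)
    (hqM : IsTurningPoint V qM) (hE₀ : V 0 < E₀) :
    ∃ C, 0 < C ∧ ∀ E, E₀ ≤ E → E ≤ C * jap (qM E) ^ (2 * l) := by
  obtain ⟨C, hC⟩ := hV.growth 0
  refine ⟨max C 1, lt_max_of_lt_right one_pos, fun E hE => ?_⟩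
  have := (le_abs_self _).trans (hC (qM E))
  simp only [iteratedDeriv_zero, Nat.cast_zero, sub_zero,
    (hqM E (hE₀.trans_le hE)).2.1] at this
  exact this.trans (mul_le_mul_of_nonneg_right (le_max_left _ _)
    (Real.rpow_pos_of_pos (jap_pos _) _).le)

theorem exists_eulerIter_div_le (hl : 1 ≤ l) (hV : GoodPotential l V)
    (hqM : IsTurningPoint V qM) (hE₀ : max (V 0) 0 < E₀) (j : ℕ) :
    ∃ C, ∀ E, E₀ ≤ E → |eulerIter V j (qM E) / E| ≤ C := by
  obtain ⟨c, hc, hcE⟩ := hV.exists_jap_rpow_le_energy hl hqM hE₀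
  obtain ⟨C, hC⟩ := (hV.isSymbolOne.eulerIter j).bound 0
  simp only [iteratedDeriv_zero, Nat.cast_zero, sub_zero] at hC
  refine ⟨C / c, fun E hE => ?_⟩
  have hj := Real.rpow_pos_of_pos (jap_pos (qM E)) (2 * l)
  have hE' : 0 < E := (max_lt_iff.1 hE₀).2.trans_le hE
  have hC₀ : 0 ≤ C := nonneg_of_mul_nonneg_left ((abs_nonneg _).trans (hC (qM E))) hj
  rw [abs_div, abs_of_pos hE', div_le_div_iff₀ hE' hc]
  calc |eulerIter V j (qM E)| * c ≤ C * jap (qM E) ^ (2 * l) * c :=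
        mul_le_mul_of_nonneg_right (hC _) hc.le
    _ = C * (c * jap (qM E) ^ (2 * l)) := by ring
    _ ≤ C * E := mul_le_mul_of_nonneg_left (hcE E hE) hC₀

theorem exists_le_eulerIter_one_div (hl : 1 ≤ l) (hV : GoodPotential l V)
    (hqM : IsTurningPoint V qM) (hE₀ : max (V 0) 0 < E₀) :
    ∃ c, 0 < c ∧ ∀ E, E₀ ≤ E → c ≤ eulerIter V 1 (qM E) / E := by
  obtain ⟨hV₀, hp₀⟩ := max_lt_iff.1 hE₀
  obtain ⟨C, hC, hCE⟩ := hV.exists_energy_le_jap_rpow hqM hV₀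
  obtain ⟨R, hR⟩ := hV.exists_half_rpow_le_id_mul_deriv hl
  have hq₀ := (hqM E₀ hV₀).1
  obtain ⟨c, hc, h⟩ := exists_mul_jap_rpow_le (p := 2 * l) (by linarith)
    hV.isSymbolOne.id_mul_deriv.smooth.continuous (δ := qM E₀)
    (fun x hx => mul_pos (hq₀.trans_le hx) (hV.deriv_pos hl (hq₀.trans_le hx))) hR
  refine ⟨c / C, div_pos hc hC, fun E hE => ?_⟩
  rw [div_le_div_iff₀ hC (hp₀.trans_le hE)]
  calc c * E ≤ c * (C * jap (qM E) ^ (2 * l)) := mul_le_mul_of_nonneg_left (hCE E hE) hc.le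
    _ = c * jap (qM E) ^ (2 * l) * C := by ring
    _ ≤ eulerIter V 1 (qM E) * C :=
      mul_le_mul_of_nonneg_right (h _ (hV.le_qM hl hqM hV₀ hE)) hC.le

theorem exists_normalizedDiff_le (hl : 1 ≤ l) (hV : GoodPotential l V)
    (hqM : IsTurningPoint V qM) (hE₀ : max (V 0) 0 < E₀) (j : ℕ) :
    ∃ C, ∀ y, ∀ E ∈ Set.Ici E₀, |normalizedDiff l (eulerIter V j) qM y E| ≤ C := by
  obtain ⟨hV₀, hp₀⟩ := max_lt_iff.1 hE₀
  obtain ⟨c, hc, hcE⟩ := hV.exists_jap_rpow_le_energy hl hqM hE₀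
  obtain ⟨C, hC₀, hC⟩ := (hV.isSymbolOne.eulerIter j).abs_sub_le (by linarith)
  refine ⟨C / c, fun ⟨y, hy, hy1⟩ E hE => ?_⟩
  have hE' : 0 < E := hp₀.trans_le hE
  have hw := one_sub_le_one_sub_rpow (p := 2 * l) (by linarith) hy hy1.le
  have hw₀ : 0 < 1 - y ^ (2 * l) := by linarith
  have hden : 0 < E * (1 - y ^ (2 * l)) := mul_pos hE' hw₀
  simp only [normalizedDiff]
  rw [abs_div, abs_of_pos hden, div_le_div_iff₀ hden hc]
  calc _ ≤ C * jap (qM E) ^ (2 * l) * (1 - y) * c := mul_le_mul_of_nonneg_right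
        (hC _ _ (hqM E (hV₀.trans_le hE)).1.le hy hy1.le) hc.le
    _ = C * ((c * jap (qM E) ^ (2 * l)) * (1 - y)) := by ring
    _ ≤ C * (E * (1 - y ^ (2 * l))) := mul_le_mul_of_nonneg_left
        (mul_le_mul (hcE E hE) hw (by linarith) hE'.le) hC₀

theorem exists_le_normalizedDiff (hl : 1 ≤ l) (hV : GoodPotential l V)
    (hqM : IsTurningPoint V qM) (hE₀ : max (V 0) 0 < E₀) :
    ∃ c, 0 < c ∧ ∀ y, ∀ E ∈ Set.Ici E₀, c ≤ normalizedDiff l V qM y E := by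
  obtain ⟨hV₀, hp₀⟩ := max_lt_iff.1 hE₀
  obtain ⟨C, hC, hCE⟩ := hV.exists_energy_le_jap_rpow hqM hV₀
  obtain ⟨c, hc, h⟩ := hV.exists_mul_le_sub hl (hqM E₀ hV₀).1
  have hC' : 0 < C * (2 * l) := mul_pos hC (by linarith)
  refine ⟨c / (C * (2 * l)), div_pos hc hC', fun ⟨y, hy, hy1⟩ E hE => ?_⟩
  have hE' : 0 < E := hp₀.trans_le hE
  have hw := one_sub_le_one_sub_rpow (p := 2 * l) (by linarith) hy hy1.le
  have hw' := one_sub_rpow_le (p := 2 * l) (by linarith) hy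
  have hw₀ : 0 < 1 - y ^ (2 * l) := by linarith
  have hj := Real.rpow_pos_of_pos (jap_pos (qM E)) (2 * l)
  simp only [normalizedDiff]
  rw [div_le_div_iff₀ hC' (mul_pos hE' hw₀)]
  calc c * (E * (1 - y ^ (2 * l)))
      ≤ c * ((C * jap (qM E) ^ (2 * l)) * (2 * l * (1 - y))) := mul_le_mul_of_nonneg_left
        (mul_le_mul (hCE E hE) hw' hw₀.le (mul_pos hC hj).le) hc.le
    _ = c * jap (qM E) ^ (2 * l) * (1 - y) * (C * (2 * l)) := by ring
    _ ≤ _ := mul_le_mul_of_nonneg_right (h _ _ (hV.le_qM hl hqM hV₀ hE) hy hy1) hC'.le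

theorem hasDerivAt_comp_turningPoint_mul (hl : 1 ≤ l) (hV : GoodPotential l V)
    (hqM : IsTurningPoint V qM) {f : ℝ → ℝ} (hf : Differentiable ℝ f) (y : ℝ) {E : ℝ}
    (hE : V 0 < E) :
    HasDerivAt (fun E => f (qM E * y))
      (qM E * y * deriv f (qM E * y) / eulerIter V 1 (qM E)) E := by
  have hq := (hqM E hE).1
  have hd := hV.deriv_pos hl hq
  refine (HasDerivAt.comp E (hf (qM E * y)).hasDerivAt
    ((hV.hasDerivAt_turningPoint hl hqM hE).mul_const y)).congr_deriv ?_
  simp only [eulerIter]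
  field_simp

theorem eulerBounded_eulerIter (hl : 1 ≤ l) (hV : GoodPotential l V)
    (hqM : IsTurningPoint V qM) (hE₀ : max (V 0) 0 < E₀) {ι : Type} (n j : ℕ) :
    EulerBounded (Set.Ici E₀) n (fun (_ : ι) E => eulerIter V j (qM E) / E) := by
  obtain ⟨hV₀, hp₀⟩ := max_lt_iff.1 hE₀
  obtain ⟨c, hc, hcb⟩ := hV.exists_le_eulerIter_one_div hl hqM hE₀
  induction n generalizing j with
  | zero =>
    obtain ⟨C, hC⟩ := hV.exists_eulerIter_div_le hl hqM hE₀ j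
    exact ⟨C, fun _ => hC⟩
  | succ n ih =>
    refine ⟨(ih j).bound, _, fun i E hE => ?_,
      (((ih 1).inv hc fun _ => hcb).mul (ih (j + 1))).sub (ih j)⟩
    have hE' : 0 < E := hp₀.trans_le hE
    have hd := hV.hasDerivAt_comp_turningPoint_mul hl hqM
      ((hV.isSymbolOne.eulerIter j).smooth.differentiable (by simp)) 1 (hV₀.trans_le hE)
    have h1 : 0 < eulerIter V 1 (qM E) :=
      (div_pos_iff_of_pos_right hE').1 (hc.trans_le (hcb E hE))
    simp only [mul_one] at hd
    refine (hd.fun_div (hasDerivAt_id' E) hE'.ne').hasDerivWithinAt.congr_deriv ?_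
    change _ = ((eulerIter V 1 (qM E) / E)⁻¹ * (qM E * deriv (eulerIter V j) (qM E) / E) - _) / E
    field_simp

theorem eulerBounded_normalizedDiff (hl : 1 ≤ l) (hV : GoodPotential l V)
    (hqM : IsTurningPoint V qM) (hE₀ : max (V 0) 0 < E₀) (n j : ℕ) :
    EulerBounded (Set.Ici E₀) n (normalizedDiff l (eulerIter V j) qM) := by
  obtain ⟨hV₀, hp₀⟩ := max_lt_iff.1 hE₀
  obtain ⟨c, hc, hcb⟩ := hV.exists_le_eulerIter_one_div hl hqM hE₀
  induction n generalizing j with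
  | zero => exact hV.exists_normalizedDiff_le hl hqM hE₀ j
  | succ n ih =>
    refine ⟨(ih j).bound, _, fun y E hE => ?_,
      (((hV.eulerBounded_eulerIter hl hqM hE₀ n 1).inv hc fun _ => hcb).mul
        (ih (j + 1))).sub (ih j)⟩
    obtain ⟨y, hy, hy1⟩ := y
    have hE' : 0 < E := hp₀.trans_le hE
    have hdf := (hV.isSymbolOne.eulerIter j).smooth.differentiable (by simp)
    have hd := hV.hasDerivAt_comp_turningPoint_mul hl hqM hdf 1 (hV₀.trans_le hE)
    have hd' := hV.hasDerivAt_comp_turningPoint_mul hl hqM hdf y (hV₀.trans_le hE)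
    have h1 : 0 < eulerIter V 1 (qM E) :=
      (div_pos_iff_of_pos_right hE').1 (hc.trans_le (hcb E hE))
    have hw := one_sub_le_one_sub_rpow (p := 2 * l) (by linarith) hy hy1.le
    have hw₀ : 0 < 1 - y ^ (2 * l) := by linarith
    simp only [mul_one] at hd
    refine ((hd.fun_sub hd').fun_div ((hasDerivAt_id' E).mul_const (1 - y ^ (2 * l)))
      (mul_pos hE' hw₀).ne').hasDerivWithinAt.congr_deriv ?_
    change _ = ((eulerIter V 1 (qM E) / E)⁻¹ * ((qM E * deriv (eulerIter V j) (qM E) -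
      qM E * y * deriv (eulerIter V j) (qM E * y)) / (E * (1 - y ^ (2 * l)))) -
      (eulerIter V j (qM E) - eulerIter V j (qM E * y)) / (E * (1 - y ^ (2 * l)))) / E
    field_simp

theorem vtil_eq_sqrt_inv (hqM : IsTurningPoint V qM) {E : ℝ}
    (hE : V 0 < E) (hE' : 0 < E) (y : Set.Ico (0 : ℝ) 1) :
    vtil l V qM E y = √(normalizedDiff l V qM y E)⁻¹ := by
  rw [vtil, normalizedDiff, (hqM E hE).2.1, abs_of_nonneg y.2.1, inv_div, one_sub_div hE'.ne',
    div_div_eq_mul_div, mul_comm E]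

theorem vtil_abs (hV : GoodPotential l V) (E y : ℝ) : vtil l V qM E |y| = vtil l V qM E y := by
  rcases abs_cases y with ⟨h, -⟩ | ⟨h, -⟩
  · rw [h]
  · rw [h, vtil, vtil, abs_neg, mul_neg, hV.even]

theorem eulerBounded_vtil (hl : 1 ≤ l) (hV : GoodPotential l V)
    (hqM : IsTurningPoint V qM) (hE₀ : max (V 0) 0 < E₀) (n : ℕ) :
    EulerBounded (Set.Ici E₀) n (fun (y : Set.Ico (0 : ℝ) 1) E => vtil l V qM E y) := by
  obtain ⟨hV₀, hp₀⟩ := max_lt_iff.1 hE₀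
  obtain ⟨c, hc, hcG⟩ := hV.exists_le_normalizedDiff hl hqM hE₀
  have hG := hV.eulerBounded_normalizedDiff hl hqM hE₀ n 0
  obtain ⟨C, hC⟩ := hG.bound
  have hC₁ : 0 < max C 1 := lt_max_of_lt_right one_pos
  refine ((hG.inv hc hcG).sqrt (inv_pos.2 hC₁) fun y E hE => ?_).congr fun y E hE =>
    vtil_eq_sqrt_inv hqM (hV₀.trans_le hE) (hp₀.trans_le hE) y
  exact inv_anti₀ (hc.trans_le (hcG y E hE))
    ((le_abs_self _).trans ((hC y E hE).trans (le_max_left _ _)))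

end GoodPotential

/-- for every `E₀ > max(V 0, 0)`, `ṽ(·,y)` is `C^∞` on `[E₀,∞)` for each
`y ∈ (-1,1)` and `|∂_E^k ṽ(E,y)| ≤ C_k E^{-k}` uniformly in `y ∈ (-1,1)`, `E ≥ E₀`. -/
theorem stmt6 (l : ℝ) (hl : 1 ≤ l) (V : ℝ → ℝ) (hV : GoodPotential l V)
    (qM : ℝ → ℝ) (hqM : IsTurningPoint V qM)
    (E₀ : ℝ) (hE₀ : max (V 0) 0 < E₀) :
    (∀ y ∈ Set.Ioo (-1 : ℝ) 1,
      ContDiffOn ℝ (⊤ : ℕ∞) (fun E => vtil l V qM E y) (Set.Ici E₀)) ∧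
    ∀ k : ℕ, ∃ C : ℝ, ∀ y ∈ Set.Ioo (-1 : ℝ) 1, ∀ E : ℝ, E₀ ≤ E →
      |iteratedDerivWithin k (fun E' => vtil l V qM E' y) (Set.Ici E₀) E|
        ≤ C * E ^ (-(k : ℝ)) := by
  have hS₀ : ∀ E ∈ Set.Ici E₀, 0 < E := fun E hE => (max_lt_iff.1 hE₀).2.trans_le hE
  have hmem : ∀ y ∈ Set.Ioo (-1 : ℝ) 1, |y| ∈ Set.Ico (0 : ℝ) 1 := fun y hy =>
    ⟨abs_nonneg y, abs_lt.2 hy⟩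
  refine ⟨fun y hy => contDiffOn_infty.2 fun n => ?_, fun k => ?_⟩
  · have := (hV.eulerBounded_vtil hl hqM hE₀ (n + 1)).contDiffOn (uniqueDiffOn_Ici E₀) hS₀
      ⟨|y|, hmem y hy⟩
    simpa only [hV.vtil_abs] using this
  · obtain ⟨h, ⟨C, hC⟩, hk⟩ := EulerBounded.iteratedDerivWithin_eq (n := 0)
      (uniqueDiffOn_Ici E₀) hS₀ k (hV.eulerBounded_vtil hl hqM hE₀ (0 + k))
    refine ⟨C, fun y hy E hE => ?_⟩
    have hE' := hS₀ E hE
    have := hk ⟨|y|, hmem y hy⟩ E hE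
    simp only [hV.vtil_abs] at this
    rw [this, abs_div, abs_of_pos (pow_pos hE' k), Real.rpow_neg hE'.le, Real.rpow_natCast,
      ← div_eq_mul_inv]
    exact div_le_div_of_nonneg_right (hC _ E hE) (pow_pos hE' k).le
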